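/- Let x : ℝ → ℝ^{n+1} solve the linear system ẋ = A x, where A = −(1/ℓ)·[[0ₙ, v],[vᵀ, 0]] ∈ so(n,1) and v : ℝ → ℝⁿ. If x_{n+1}(t) > 0 on an interval, then r(t) := (x₁,…,xₙ)/x_{n+1} solves the bicycle equation ℓ·ṙ = −v + (v·r)r in ℝⁿ. -/

import Mathlib

/-- The bicycle equation in ℝⁿ is the projection, via (x, x_{n+1}) ↦ x / x_{n+1},
of the linear system ẋ = −(1/ℓ)·[[0ₙ, v],[vᵀ, 0]]·x in ℝ^{n,1}. -/
theorem bicycle_equation_lorentz_lift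
    {n : ℕ} (ℓ : ℝ) (hℓ : 0 < ℓ) (v : ℝ → Fin n → ℝ) (hv : Continuous v)
    (x : ℝ → Fin (n + 1) → ℝ) (hx : ∀ i, Differentiable ℝ fun t => x t i)
    (hode : ∀ t, ∀ i : Fin n,
      deriv (fun s => x s i.castSucc) t = -(1 / ℓ) * v t i * x t (Fin.last n))
    (hodeLast : ∀ t,
      deriv (fun s => x s (Fin.last n)) t = -(1 / ℓ) * ∑ i : Fin n, v t i * x t i.castSucc)
    (s : Set ℝ) (hs : IsOpen s) (hpos : ∀ t ∈ s, 0 < x t (Fin.last n))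
    (r : ℝ → Fin n → ℝ) (hr : r = fun t i => x t i.castSucc / x t (Fin.last n)) :
    ∀ t ∈ s, ∀ i : Fin n,
      ℓ * deriv (fun u => r u i) t = -v t i + (∑ j : Fin n, v t j * r t j) * r t i := by
  subst hr
  intro t ht i
  have hne : x t (Fin.last n) ≠ 0 := (hpos t ht).ne'
  have hsum : ∑ j : Fin n, v t j * (x t j.castSucc / x t (Fin.last n)) =
      (∑ j : Fin n, v t j * x t j.castSucc) / x t (Fin.last n) := by
    simp only [Finset.sum_div, mul_div_assoc]
  have hderiv := ((hx i.castSucc t).hasDerivAt.fun_div (hx (Fin.last n) t).hasDerivAt hne).deriv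
  rw [hode, hodeLast] at hderiv
  simp only [hsum, hderiv]
  field_simp
  ring
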